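/- arXiv:2603.07094 — 3 statements merged into one kernel-verified Lean document; each statement's English description precedes it below -/
import Mathlib

section
/- For every state s of the game, the value iteration sequence (v_n(s)) converges, and its limit equals the max-min value w(s) of the game started at s. -/
/-!
Common framework: team concurrent stochastic reachability games.
-/

noncomputable section

/-- A concurrent game structure: finitely many players, finitely many states,
finitely many actions per player, available actions, and a probabilistic
transition function. -/
structure GameStructure where
  Player : Type
  [playerFin : Fintype Player]
  [playerDec : DecidableEq Player]
  State : Type
  [stateFin : Fintype State]
  [stateDec : DecidableEq State]
  Act : Player → Type
  [actFin : ∀ p, Fintype (Act p)]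
  [actDec : ∀ p, DecidableEq (Act p)]
  Av : (p : Player) → State → Finset (Act p)
  av_nonempty : ∀ p s, (Av p s).Nonempty
  trans : State → ((p : Player) → Act p) → State → ℝ
  trans_nonneg : ∀ s a t, 0 ≤ trans s a t
  trans_sum : ∀ s a, ∑ t, trans s a t = 1

attribute [instance] GameStructure.playerFin GameStructure.playerDec
  GameStructure.stateFin GameStructure.stateDec GameStructure.actFin GameStructure.actDec

/-- A (behavioural) strategy of player `p`: a distribution over available
actions, for every history `h` (the list of previously visited states)
and current state `s`. -/
structure Strategy (G : GameStructure) (p : G.Player) where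
  toFun : List G.State → G.State → G.Act p → ℝ
  nonneg : ∀ h s a, 0 ≤ toFun h s a
  support_av : ∀ h s a, a ∉ G.Av p s → toFun h s a = 0
  sum_one : ∀ h s, ∑ a, toFun h s a = 1

/-- A strategy is memoryless if it only depends on the current state. -/
def Strategy.Memoryless {G : GameStructure} {p : G.Player} (σ : Strategy G p) : Prop :=
  ∀ h h' s, σ.toFun h s = σ.toFun h' s

/-- A strategy is deterministic if it always plays a single action with probability 1. -/
def Strategy.Deterministic {G : GameStructure} {p : G.Player} (σ : Strategy G p) : Prop :=
  ∀ h s, ∃ a, σ.toFun h s a = 1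

/-- A selector of player `p` at state `s`: a distribution over the available actions. -/
structure Selector (G : GameStructure) (p : G.Player) (s : G.State) where
  toFun : G.Act p → ℝ
  nonneg : ∀ a, 0 ≤ toFun a
  support_av : ∀ a, a ∉ G.Av p s → toFun a = 0
  sum_one : ∑ a, toFun a = 1

/-- A game: a game structure together with a team, an absorbing target set,
and an initial state. -/
structure Game extends GameStructure where
  team : Finset Player
  target : Finset State
  init : State
  absorbing : ∀ t ∈ target, ∀ a, trans t a t = 1

namespace Game

variable (Gm : Game)

abbrev TeamPlayer := {p : Gm.Player // p ∈ Gm.team}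
abbrev OppPlayer := {p : Gm.Player // p ∉ Gm.team}

/-- A collective strategy: one strategy for each team player. -/
abbrev TeamStrategy := (p : Gm.TeamPlayer) → Strategy Gm.toGameStructure p.1
/-- An opponent strategy: one strategy for each player outside the team. -/
abbrev OppStrategy := (p : Gm.OppPlayer) → Strategy Gm.toGameStructure p.1

abbrev TeamAct := (p : Gm.TeamPlayer) → Gm.Act p.1
abbrev OppAct := (p : Gm.OppPlayer) → Gm.Act p.1

/-- A collective selector at state `s`. -/
abbrev TeamSelector (s : Gm.State) := (p : Gm.TeamPlayer) → Selector Gm.toGameStructure p.1 s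

def MemorylessTeam (σ : Gm.TeamStrategy) : Prop := ∀ p, (σ p).Memoryless
def DeterministicTeam (σ : Gm.TeamStrategy) : Prop := ∀ p, (σ p).Deterministic
def MemorylessOpp (τ : Gm.OppStrategy) : Prop := ∀ p, (τ p).Memoryless

/-- Combine a collective strategy and an opponent strategy into a full profile. -/
def combine (σ : Gm.TeamStrategy) (τ : Gm.OppStrategy) (p : Gm.Player) :
    Strategy Gm.toGameStructure p :=
  if h : p ∈ Gm.team then σ ⟨p, h⟩ else τ ⟨p, h⟩

/-- Combine a joint team action and a joint opponent action into a full action profile. -/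
def combineAct (a : Gm.TeamAct) (b : Gm.OppAct) (p : Gm.Player) : Gm.Act p :=
  if h : p ∈ Gm.team then a ⟨p, h⟩ else b ⟨p, h⟩

/-- A joint opponent action is available at `s`. -/
def OppAvailable (s : Gm.State) (b : Gm.OppAct) : Prop := ∀ p, b p ∈ Gm.Av p.1 s

/-- One-step transition probability, under a full strategy profile, from state `s`
with history `h`, to state `t` (players randomise independently). -/
def stepProb (π : (p : Gm.Player) → Strategy Gm.toGameStructure p)
    (h : List Gm.State) (s t : Gm.State) : ℝ :=
  ∑ a : (p : Gm.Player) → Gm.Act p, (∏ p, (π p).toFun h s (a p)) * Gm.trans s a t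

/-- Probability of visiting the target within `n` steps, starting at state `s`
with history `h`. -/
def reachWithin (π : (p : Gm.Player) → Strategy Gm.toGameStructure p) :
    ℕ → List Gm.State → Gm.State → ℝ
  | 0, _, s => if s ∈ Gm.target then 1 else 0
  | n + 1, h, s =>
      if s ∈ Gm.target then 1
      else ∑ t, Gm.stepProb π h s t * reachWithin π n (h ++ [s]) t

/-- Probability of eventually reaching the target set, starting from state `s`. -/
def reachProbFrom (π : (p : Gm.Player) → Strategy Gm.toGameStructure p) (s : Gm.State) : ℝ :=
  ⨆ n : ℕ, Gm.reachWithin π n [] s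

/-- Probability of eventually reaching the target set from the initial state. -/
def reachProb (π : (p : Gm.Player) → Strategy Gm.toGameStructure p) : ℝ :=
  Gm.reachProbFrom π Gm.init

/-- Probability of visiting the target set for the first time exactly at step `k`. -/
def firstHit (π : (p : Gm.Player) → Strategy Gm.toGameStructure p) :
    ℕ → List Gm.State → Gm.State → ℝ
  | 0, _, s => if s ∈ Gm.target then 1 else 0
  | k + 1, h, s =>
      if s ∈ Gm.target then 0
      else ∑ t, Gm.stepProb π h s t * firstHit π k (h ++ [s]) t

/-- Expected `lam`-discounted payoff from the initial state: the play pays `lam ^ k`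
if it first visits the target at step `k`, and `0` if it never visits the target. -/
def discounted (π : (p : Gm.Player) → Strategy Gm.toGameStructure p) (lam : ℝ) : ℝ :=
  ∑' k : ℕ, lam ^ k * Gm.firstHit π k [] Gm.init

/-- A play (an infinite sequence of states from the initial state) is compatible with
a strategy profile if each of its transitions occurs with positive probability. -/
def CompatiblePlay (π : (p : Gm.Player) → Strategy Gm.toGameStructure p)
    (play : ℕ → Gm.State) : Prop :=
  play 0 = Gm.init ∧
  ∀ n, 0 < Gm.stepProb π (List.ofFn fun i : Fin n => play i.1) (play n) (play (n + 1))

/-- Expected value of the valuation `v` at the successor of `s`, when the team plays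
according to the collective selector `ξ` and the opponent plays the joint action `b`. -/
def preTeamAct (v : Gm.State → ℝ) (s : Gm.State) (ξ : Gm.TeamSelector s) (b : Gm.OppAct) : ℝ :=
  ∑ a : Gm.TeamAct, (∏ p, (ξ p).toFun (a p)) * ∑ t, Gm.trans s (Gm.combineAct a b) t * v t

/-- An opponent selector at state `s`: a distribution over available joint opponent actions. -/
structure OppSelector (s : Gm.State) where
  toFun : Gm.OppAct → ℝ
  nonneg : ∀ b, 0 ≤ toFun b
  support_av : ∀ b, ¬ Gm.OppAvailable s b → toFun b = 0
  sum_one : ∑ b, toFun b = 1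

/-- Expected value of `v` at the successor of `s` under a collective selector `ξ`
and an opponent selector `ζ`. -/
def preSel (v : Gm.State → ℝ) (s : Gm.State) (ξ : Gm.TeamSelector s) (ζ : Gm.OppSelector s) : ℝ :=
  ∑ b, ζ.toFun b * Gm.preTeamAct v s ξ b

/-- The predecessor operator: best one-step value the team can guarantee. -/
def pre (v : Gm.State → ℝ) (s : Gm.State) : ℝ :=
  ⨆ ξ : Gm.TeamSelector s, ⨅ ζ : Gm.OppSelector s, Gm.preSel v s ξ ζ

/-- The value iteration sequence: `vIter 0` is the indicator of the target set
and `vIter (n+1) = pre (vIter n)`. -/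
def vIter : ℕ → Gm.State → ℝ
  | 0 => fun s => if s ∈ Gm.target then 1 else 0
  | n + 1 => Gm.pre (vIter n)

/-- The max-min value of the game started at `s`. -/
def maxminFrom (s : Gm.State) : ℝ :=
  ⨆ σ : Gm.TeamStrategy, ⨅ τ : Gm.OppStrategy, Gm.reachProbFrom (Gm.combine σ τ) s

/-- The set of states from which the team can win almost surely. -/
def winSet : Set Gm.State :=
  {s | ∃ σ : Gm.TeamStrategy, ∀ τ : Gm.OppStrategy, Gm.reachProbFrom (Gm.combine σ τ) s = 1}

/-- Distribution of the successor of `s` when the team plays the collective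
selector `ξ` and the opponent plays the joint action `b`. -/
def succProbSel (s : Gm.State) (ξ : Gm.TeamSelector s) (b : Gm.OppAct) (t : Gm.State) : ℝ :=
  ∑ a : Gm.TeamAct, (∏ p, (ξ p).toFun (a p)) * Gm.trans s (Gm.combineAct a b) t

/-- Distribution of the successor of `s` (with history `h`) when the team plays the
collective strategy `σ` and the opponent plays the joint action `b`. -/
def succProbTeam (σ : Gm.TeamStrategy) (h : List Gm.State) (s : Gm.State)
    (b : Gm.OppAct) (t : Gm.State) : ℝ :=
  ∑ a : Gm.TeamAct, (∏ p, (σ p).toFun h s (a p)) * Gm.trans s (Gm.combineAct a b) t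

/-- The layered decomposition of the almost-sure winning set. -/
def wSeq : ℕ → Set Gm.State
  | 0 => ↑Gm.target
  | k + 1 =>
      wSeq k ∪
      {s ∈ Gm.winSet | ∃ ξ : Gm.TeamSelector s, ∀ b : Gm.OppAct, Gm.OppAvailable s b →
        (0 < ∑ t, (wSeq k).indicator (Gm.succProbSel s ξ b) t) ∧
        (∑ t, Gm.winSet.indicator (Gm.succProbSel s ξ b) t = 1)}

end Game

/-- Comparing two weighted averages whose values differ by at most `c` on the support. -/
theorem sum_weight_mul_le_add {ι : Type*} [Fintype ι] {w f g : ι → ℝ} {c : ℝ}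
    (hw : ∀ i, 0 ≤ w i) (hw1 : ∑ i, w i = 1) (h : ∀ i, w i ≠ 0 → f i ≤ g i + c) :
    ∑ i, w i * f i ≤ ∑ i, w i * g i + c := by
  have hc : ∑ i, w i * g i + c = ∑ i, w i * (g i + c) := by
    simp only [mul_add, Finset.sum_add_distrib, ← Finset.sum_mul, hw1, one_mul]
  rw [hc]
  refine Finset.sum_le_sum fun i _ => ?_
  by_cases hi : w i = 0
  · simp [hi]
  · exact mul_le_mul_of_nonneg_left (h i hi) (hw i)

/-- A product of probability distributions is a probability distribution. -/
theorem sum_prod_eq_one {ι : Type*} [Fintype ι] [DecidableEq ι] {α : ι → Type*}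
    [∀ i, Fintype (α i)] (f : ∀ i, α i → ℝ) (hf : ∀ i, ∑ a, f i a = 1) :
    ∑ a : ∀ i, α i, ∏ i, f i (a i) = 1 := by
  rw [← Fintype.prod_sum]
  simp [hf]

/-- The selector playing a fixed available action. -/
def Selector.pure {G : GameStructure} {p : G.Player} {s : G.State} (a : G.Act p)
    (ha : a ∈ G.Av p s) : Selector G p s where
  toFun a' := if a' = a then 1 else 0
  nonneg a' := by split_ifs <;> norm_num
  support_av a' h' := if_neg (by rintro rfl; exact h' ha)
  sum_one := by simp

instance {G : GameStructure} {p : G.Player} {s : G.State} : Nonempty (Selector G p s) :=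
  ⟨Selector.pure _ (G.av_nonempty p s).choose_spec⟩

/-- The strategy assembled from a choice of selector at every history. -/
def Strategy.ofSelector {G : GameStructure} {p : G.Player}
    (ξ : List G.State → (s : G.State) → Selector G p s) : Strategy G p where
  toFun h s := (ξ h s).toFun
  nonneg h s := (ξ h s).nonneg
  support_av h s := (ξ h s).support_av
  sum_one h s := (ξ h s).sum_one

/-- The selector played by a strategy at a given history. -/
def Strategy.selector {G : GameStructure} {p : G.Player} (σ : Strategy G p)
    (h : List G.State) (s : G.State) : Selector G p s where
  toFun := σ.toFun h s
  nonneg := σ.nonneg h s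
  support_av := σ.support_av h s
  sum_one := σ.sum_one h s

instance {G : GameStructure} {p : G.Player} : Nonempty (Strategy G p) :=
  ⟨Strategy.ofSelector fun _ _ => Classical.arbitrary _⟩

namespace Game

/-- The opponent selector in which the opponent players randomise independently. -/
def OppSelector.prod {Gm : Game} {s : Gm.State}
    (ζ : (p : Gm.OppPlayer) → Selector Gm.toGameStructure p.1 s) : Gm.OppSelector s where
  toFun b := ∏ p, (ζ p).toFun (b p)
  nonneg b := Finset.prod_nonneg fun p _ => (ζ p).nonneg _
  support_av b hb := by
    obtain ⟨p, hp⟩ := not_forall.1 hb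
    exact Finset.prod_eq_zero (Finset.mem_univ p) ((ζ p).support_av _ hp)
  sum_one := sum_prod_eq_one (fun p => (ζ p).toFun) fun p => (ζ p).sum_one

instance {Gm : Game} {s : Gm.State} : Nonempty (Gm.OppSelector s) :=
  ⟨OppSelector.prod fun _ => Classical.arbitrary _⟩

variable (Gm : Game)

theorem preTeamAct_le_add {u v : Gm.State → ℝ} {c : ℝ} (h : ∀ t, u t ≤ v t + c) (s : Gm.State)
    (ξ : Gm.TeamSelector s) (b : Gm.OppAct) :
    Gm.preTeamAct u s ξ b ≤ Gm.preTeamAct v s ξ b + c :=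
  sum_weight_mul_le_add (fun _ => Finset.prod_nonneg fun p _ => (ξ p).nonneg _)
    (sum_prod_eq_one (fun p => (ξ p).toFun) fun p => (ξ p).sum_one) fun _ _ =>
    sum_weight_mul_le_add (fun t => Gm.trans_nonneg _ _ t) (Gm.trans_sum _ _) fun t _ => h t

theorem preSel_le_add {u v : Gm.State → ℝ} {c : ℝ} (h : ∀ t, u t ≤ v t + c) (s : Gm.State)
    (ξ : Gm.TeamSelector s) (ζ : Gm.OppSelector s) :
    Gm.preSel u s ξ ζ ≤ Gm.preSel v s ξ ζ + c :=
  sum_weight_mul_le_add ζ.nonneg ζ.sum_one fun b _ => Gm.preTeamAct_le_add h s ξ b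

theorem preSel_zero (s : Gm.State) (ξ : Gm.TeamSelector s) (ζ : Gm.OppSelector s) :
    Gm.preSel 0 s ξ ζ = 0 := by
  simp [preSel, preTeamAct]

theorem preSel_nonneg {v : Gm.State → ℝ} (h : ∀ t, 0 ≤ v t) (s : Gm.State)
    (ξ : Gm.TeamSelector s) (ζ : Gm.OppSelector s) : 0 ≤ Gm.preSel v s ξ ζ := by
  simpa [preSel_zero] using Gm.preSel_le_add (u := 0) (v := v) (c := 0) (by simpa using h) s ξ ζ

theorem preSel_le_one {v : Gm.State → ℝ} (h : ∀ t, v t ≤ 1) (s : Gm.State)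
    (ξ : Gm.TeamSelector s) (ζ : Gm.OppSelector s) : Gm.preSel v s ξ ζ ≤ 1 := by
  simpa [preSel_zero] using Gm.preSel_le_add (u := v) (v := 0) (c := 1) (by simpa using h) s ξ ζ

theorem trans_target {s : Gm.State} (hs : s ∈ Gm.target) (a : (p : Gm.Player) → Gm.Act p)
    {t : Gm.State} (ht : t ≠ s) : Gm.trans s a t = 0 := by
  have h := Gm.trans_sum s a
  rw [← Finset.add_sum_erase _ _ (Finset.mem_univ s), Gm.absorbing s hs a, add_eq_left,
    Finset.sum_eq_zero_iff_of_nonneg fun t _ => Gm.trans_nonneg s a t] at h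
  exact h t (by simp [ht])

theorem preSel_target {s : Gm.State} (hs : s ∈ Gm.target) (v : Gm.State → ℝ)
    (ξ : Gm.TeamSelector s) (ζ : Gm.OppSelector s) : Gm.preSel v s ξ ζ = v s := by
  have h (a : (p : Gm.Player) → Gm.Act p) : ∑ t, Gm.trans s a t * v t = v s := by
    rw [Finset.sum_eq_single s (fun t _ ht => by rw [Gm.trans_target hs a ht, zero_mul])
      (by simp), Gm.absorbing s hs a, one_mul]
  simp only [preSel, preTeamAct, h, ← Finset.sum_mul]
  rw [sum_prod_eq_one (fun p => (ξ p).toFun) fun p => (ξ p).sum_one, ζ.sum_one, one_mul, one_mul]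

theorem pre_target {s : Gm.State} (hs : s ∈ Gm.target) (v : Gm.State → ℝ) :
    Gm.pre v s = v s := by
  simp [pre, Gm.preSel_target hs]

/-- The valuation takes values in the unit interval. -/
def UnitValued (v : Gm.State → ℝ) : Prop := ∀ t, 0 ≤ v t ∧ v t ≤ 1

section UnitValued

variable {Gm} {v : Gm.State → ℝ} (hv : Gm.UnitValued v) (s : Gm.State)
include hv

theorem UnitValued.bddBelow_preSel (ξ : Gm.TeamSelector s) :
    BddBelow (Set.range fun ζ => Gm.preSel v s ξ ζ) :=
  ⟨0, Set.forall_mem_range.2 fun ζ => Gm.preSel_nonneg (fun t => (hv t).1) s ξ ζ⟩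

theorem UnitValued.iInf_preSel_le_one (ξ : Gm.TeamSelector s) :
    ⨅ ζ, Gm.preSel v s ξ ζ ≤ 1 :=
  (ciInf_le (hv.bddBelow_preSel s ξ) (Classical.arbitrary _)).trans
    (Gm.preSel_le_one (fun t => (hv t).2) s ξ _)

theorem UnitValued.iInf_preSel_le_pre (ξ : Gm.TeamSelector s) :
    ⨅ ζ, Gm.preSel v s ξ ζ ≤ Gm.pre v s :=
  le_ciSup (f := fun ξ : Gm.TeamSelector s => ⨅ ζ, Gm.preSel v s ξ ζ)
    ⟨1, Set.forall_mem_range.2 fun ξ => hv.iInf_preSel_le_one s ξ⟩ ξ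

theorem UnitValued.pre : Gm.UnitValued (Gm.pre v) := fun s =>
  ⟨(le_ciInf fun ζ => Gm.preSel_nonneg (fun t => (hv t).1) s _ ζ).trans
    (hv.iInf_preSel_le_pre s (Classical.arbitrary _)),
    ciSup_le fun ξ => hv.iInf_preSel_le_one s ξ⟩

theorem UnitValued.pre_le_add {u : Gm.State → ℝ} (hu : Gm.UnitValued u) {c : ℝ}
    (h : ∀ t, v t ≤ u t + c) : Gm.pre v s ≤ Gm.pre u s + c := by
  refine ciSup_le fun ξ => ?_
  rw [← sub_le_iff_le_add]
  refine le_trans (le_ciInf fun ζ => ?_) (hu.iInf_preSel_le_pre s ξ)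
  rw [sub_le_iff_le_add]
  exact (ciInf_le (hv.bddBelow_preSel s ξ) ζ).trans (Gm.preSel_le_add h s ξ ζ)

theorem UnitValued.exists_selector {ε : ℝ} (hε : 0 < ε) :
    ∃ ξ : Gm.TeamSelector s, ∀ ζ, Gm.pre v s ≤ Gm.preSel v s ξ ζ + ε := by
  obtain ⟨ξ, hξ⟩ := exists_lt_of_lt_ciSup (show Gm.pre v s - ε < Gm.pre v s by linarith)
  exact ⟨ξ, fun ζ => by linarith [ciInf_le (hv.bddBelow_preSel s ξ) ζ]⟩

/-- Against every collective selector the opponent has an available joint action which keeps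
the expected value below `pre`. -/
theorem UnitValued.exists_oppAct (ξ : Gm.TeamSelector s) :
    ∃ b, Gm.OppAvailable s b ∧ Gm.preTeamAct v s ξ b ≤ Gm.pre v s := by
  classical
  obtain ⟨b, hb, hmin⟩ := Finset.exists_min_image
    (Finset.univ.filter fun b => Gm.OppAvailable s b) (Gm.preTeamAct v s ξ)
    ⟨fun p => (Gm.av_nonempty p.1 s).choose,
      Finset.mem_filter.2 ⟨Finset.mem_univ _, fun p => (Gm.av_nonempty p.1 s).choose_spec⟩⟩
  refine ⟨b, (Finset.mem_filter.1 hb).2, le_trans (le_ciInf fun ζ => ?_)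
    (hv.iInf_preSel_le_pre s ξ)⟩
  have h := sum_weight_mul_le_add (f := fun _ => Gm.preTeamAct v s ξ b)
    (g := Gm.preTeamAct v s ξ) (c := 0) ζ.nonneg ζ.sum_one fun b' hb' => by
      rw [add_zero]
      refine hmin b' (Finset.mem_filter.2 ⟨Finset.mem_univ _, ?_⟩)
      by_contra hn
      exact hb' (ζ.support_av b' hn)
  rwa [← Finset.sum_mul, ζ.sum_one, one_mul, add_zero] at h

end UnitValued

theorem unitValued_vIter (n : ℕ) : Gm.UnitValued (Gm.vIter n) := by
  induction n with
  | zero => intro t; simp only [vIter]; split_ifs <;> norm_num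
  | succ n ih => exact ih.pre

theorem vIter_target {s : Gm.State} (hs : s ∈ Gm.target) (n : ℕ) : Gm.vIter n s = 1 := by
  induction n with
  | zero => simp [vIter, hs]
  | succ n ih => rw [vIter, Gm.pre_target hs, ih]

theorem vIter_le_succ (n : ℕ) (s : Gm.State) : Gm.vIter n s ≤ Gm.vIter (n + 1) s := by
  induction n generalizing s with
  | zero =>
    by_cases hs : s ∈ Gm.target
    · simp [Gm.vIter_target hs]
    · simpa [vIter, hs] using (Gm.unitValued_vIter 1 s).1
  | succ n ih =>
    have h := (Gm.unitValued_vIter n).pre_le_add s (Gm.unitValued_vIter (n + 1)) (c := 0)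
      (by simpa using ih)
    rwa [add_zero] at h

theorem monotone_vIter (s : Gm.State) : Monotone fun n => Gm.vIter n s :=
  monotone_nat_of_le_succ fun n => Gm.vIter_le_succ n s

/-- The limit of the value iteration sequence. -/
def vLim (s : Gm.State) : ℝ := ⨆ n, Gm.vIter n s

theorem bddAbove_vIter (s : Gm.State) : BddAbove (Set.range fun n => Gm.vIter n s) :=
  ⟨1, Set.forall_mem_range.2 fun n => (Gm.unitValued_vIter n s).2⟩

theorem tendsto_vIter (s : Gm.State) :
    Filter.Tendsto (fun n => Gm.vIter n s) Filter.atTop (nhds (Gm.vLim s)) :=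
  tendsto_atTop_ciSup (Gm.monotone_vIter s) (Gm.bddAbove_vIter s)

theorem vIter_le_vLim (n : ℕ) (s : Gm.State) : Gm.vIter n s ≤ Gm.vLim s :=
  le_ciSup (Gm.bddAbove_vIter s) n

theorem unitValued_vLim : Gm.UnitValued Gm.vLim := fun s =>
  ⟨(Gm.unitValued_vIter 0 s).1.trans (Gm.vIter_le_vLim 0 s),
    ciSup_le fun n => (Gm.unitValued_vIter n s).2⟩

theorem pre_vLim_le (s : Gm.State) : Gm.pre Gm.vLim s ≤ Gm.vLim s := by
  refine le_of_forall_pos_le_add fun ε hε => ?_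
  have hev : ∀ᶠ n in Filter.atTop, ∀ t, Gm.vLim t < Gm.vIter n t + ε :=
    Filter.eventually_all.2 fun t =>
      ((Gm.tendsto_vIter t).eventually (lt_mem_nhds (sub_lt_self _ hε))).mono
        fun n hn => by linarith
  obtain ⟨n, hn⟩ := hev.exists
  have h := Gm.unitValued_vLim.pre_le_add s (Gm.unitValued_vIter n) fun t => (hn t).le
  linarith [show Gm.pre (Gm.vIter n) s ≤ _ from Gm.vIter_le_vLim (n + 1) s]

/-- The expectation of `f` after one step of a combined profile, in terms of the selectors
played at the current history. -/
theorem sum_stepProb_combine (σ : Gm.TeamStrategy) (τ : Gm.OppStrategy) (h : List Gm.State)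
    (s : Gm.State) (f : Gm.State → ℝ) :
    ∑ t, Gm.stepProb (Gm.combine σ τ) h s t * f t =
      Gm.preSel f s (fun p => (σ p).selector h s)
        (OppSelector.prod fun p => (τ p).selector h s) := by
  have hstep : ∑ t, Gm.stepProb (Gm.combine σ τ) h s t * f t =
      ∑ a : (p : Gm.Player) → Gm.Act p,
        (∏ p, (Gm.combine σ τ p).toFun h s (a p)) * ∑ t, Gm.trans s a t * f t := by
    simp only [stepProb, Finset.sum_mul, Finset.mul_sum]
    rw [Finset.sum_comm]
    simp only [mul_assoc]
  rw [hstep, ← (Equiv.piEquivPiSubtypeProd (fun p => p ∈ Gm.team) Gm.Act).symm.sum_comp,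
    Fintype.sum_prod_type_right]
  simp only [preSel, preTeamAct, Finset.mul_sum (Finset.univ : Finset Gm.TeamAct)]
  refine Finset.sum_congr rfl fun b _ => Finset.sum_congr rfl fun a _ => ?_
  rw [← mul_assoc]
  congr 1
  rw [← Fintype.prod_subtype_mul_prod_subtype (fun p => p ∈ Gm.team), mul_comm]
  congr 1
  · refine Fintype.prod_congr _ _ fun (p : Gm.OppPlayer) => ?_
    simp [combine, p.2, Strategy.selector, Equiv.piEquivPiSubtypeProd]
  · refine Finset.prod_bijective id Function.bijective_id (by simp)
      fun (p : Gm.TeamPlayer) _ => ?_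
    simp [combine, p.2, Strategy.selector, Equiv.piEquivPiSubtypeProd]

theorem unitValued_reachWithin (σ : Gm.TeamStrategy) (τ : Gm.OppStrategy) (n : ℕ)
    (h : List Gm.State) : Gm.UnitValued (Gm.reachWithin (Gm.combine σ τ) n h) := by
  induction n generalizing h with
  | zero => intro s; simp only [reachWithin]; split_ifs <;> norm_num
  | succ n ih =>
    intro s
    simp only [reachWithin]
    split_ifs
    · norm_num
    · rw [sum_stepProb_combine]
      exact ⟨Gm.preSel_nonneg (fun t => (ih _ t).1) _ _ _,
        Gm.preSel_le_one (fun t => (ih _ t).2) _ _ _⟩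

theorem bddAbove_reachWithin (σ : Gm.TeamStrategy) (τ : Gm.OppStrategy) (s : Gm.State) :
    BddAbove (Set.range fun n => Gm.reachWithin (Gm.combine σ τ) n [] s) :=
  ⟨1, Set.forall_mem_range.2 fun n => (Gm.unitValued_reachWithin σ τ n [] s).2⟩

theorem reachProbFrom_nonneg (σ : Gm.TeamStrategy) (τ : Gm.OppStrategy) (s : Gm.State) :
    0 ≤ Gm.reachProbFrom (Gm.combine σ τ) s :=
  (Gm.unitValued_reachWithin σ τ 0 [] s).1.trans (le_ciSup (Gm.bddAbove_reachWithin σ τ s) 0)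

theorem bddBelow_reachProbFrom (σ : Gm.TeamStrategy) (s : Gm.State) :
    BddBelow (Set.range fun τ => Gm.reachProbFrom (Gm.combine σ τ) s) :=
  ⟨0, Set.forall_mem_range.2 fun τ => Gm.reachProbFrom_nonneg σ τ s⟩

/-- The opponent can keep the reachability probability below the limit of value iteration. -/
theorem exists_oppStrategy_reachProbFrom_le (σ : Gm.TeamStrategy) :
    ∃ τ : Gm.OppStrategy, ∀ s, Gm.reachProbFrom (Gm.combine σ τ) s ≤ Gm.vLim s := by
  choose b hav hb using fun (h : List Gm.State) (s : Gm.State) =>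
    Gm.unitValued_vLim.exists_oppAct s fun p => (σ p).selector h s
  let τ : Gm.OppStrategy := fun p => Strategy.ofSelector fun h s => .pure (b h s p) (hav h s p)
  have hpure (h : List Gm.State) (s : Gm.State) (ξ : Gm.TeamSelector s) (v : Gm.State → ℝ) :
      Gm.preSel v s ξ (OppSelector.prod fun p => (τ p).selector h s) =
        Gm.preTeamAct v s ξ (b h s) := by
    have hprod (b' : Gm.OppAct) : (∏ p, if b' p = b h s p then (1 : ℝ) else 0) =
        if b' = b h s then 1 else 0 := by
      simp [Finset.prod_ite_zero, funext_iff]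
    simp [preSel, OppSelector.prod, Strategy.selector, τ, Strategy.ofSelector, Selector.pure,
      hprod]
  have hle (n : ℕ) (h : List Gm.State) (s : Gm.State) :
      Gm.reachWithin (Gm.combine σ τ) n h s ≤ Gm.vLim s := by
    induction n generalizing h s with
    | zero => exact Gm.vIter_le_vLim 0 s
    | succ n ih =>
      rw [reachWithin]
      split_ifs with hs
      · exact (Gm.vIter_target hs 0).symm.le.trans (Gm.vIter_le_vLim 0 s)
      · rw [sum_stepProb_combine]
        have := Gm.preSel_le_add (c := 0) (fun t => by simpa using ih (h ++ [s]) t) s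
          (fun p => (σ p).selector h s) (OppSelector.prod fun p => (τ p).selector h s)
        rw [hpure h s _ Gm.vLim, add_zero] at this
        exact this.trans ((hb h s).trans (Gm.pre_vLim_le s))
  exact ⟨τ, fun s => ciSup_le fun n => hle n [] s⟩

/-- Playing nearly optimal selectors for the remaining horizon nearly achieves the value of
`n` steps of value iteration. -/
theorem exists_teamStrategy_le_reachWithin (n : ℕ) {ε : ℝ} (hε : 0 < ε) :
    ∃ σ : Gm.TeamStrategy, ∀ (τ : Gm.OppStrategy) (s : Gm.State),
      Gm.vIter n s ≤ Gm.reachWithin (Gm.combine σ τ) n [] s + n * ε := by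
  choose ξ hξ using fun (m : ℕ) (s : Gm.State) => (Gm.unitValued_vIter m).exists_selector s hε
  let σ : Gm.TeamStrategy := fun p =>
    Strategy.ofSelector fun h s => ξ (n - h.length - 1) s p
  have key (τ : Gm.OppStrategy) (m : ℕ) (h : List Gm.State) (s : Gm.State)
      (hm : h.length + m = n) :
      Gm.vIter m s ≤ Gm.reachWithin (Gm.combine σ τ) m h s + m * ε := by
    induction m generalizing h s with
    | zero => simp [vIter, reachWithin]
    | succ m ih =>
      rw [reachWithin]
      split_ifs with hs
      · rw [Gm.vIter_target hs]
        exact le_add_of_nonneg_right (by positivity)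
      · rw [sum_stepProb_combine]
        have hsel : (fun p => (σ p).selector h s) = ξ m s := by
          have : n - h.length - 1 = m := by omega
          subst this
          rfl
        rw [hsel]
        have hstep := Gm.preSel_le_add
          (fun t => ih (h ++ [s]) t (by
            simp only [List.length_append, List.length_singleton]; omega))
          s (ξ m s) (OppSelector.prod fun p => (τ p).selector h s)
        have hopt := hξ m s (OppSelector.prod fun p => (τ p).selector h s)
        rw [vIter]
        push_cast
        linarith
  exact ⟨σ, fun τ s => key τ n [] s (by simp)⟩

theorem iInf_reachProbFrom_le_vLim (σ : Gm.TeamStrategy) (s : Gm.State) :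
    ⨅ τ, Gm.reachProbFrom (Gm.combine σ τ) s ≤ Gm.vLim s := by
  obtain ⟨τ, hτ⟩ := Gm.exists_oppStrategy_reachProbFrom_le σ
  exact (ciInf_le (Gm.bddBelow_reachProbFrom σ s) τ).trans (hτ s)

theorem vIter_le_maxminFrom (n : ℕ) (s : Gm.State) : Gm.vIter n s ≤ Gm.maxminFrom s := by
  refine le_of_forall_pos_le_add fun ε hε => ?_
  obtain ⟨σ, hσ⟩ := Gm.exists_teamStrategy_le_reachWithin n
    (show 0 < ε / (n + 1) by positivity)
  have hn : n * (ε / (n + 1)) ≤ ε := by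
    rw [mul_div_assoc', div_le_iff₀ (by positivity)]
    nlinarith
  have hinf : Gm.vIter n s - ε ≤ ⨅ τ, Gm.reachProbFrom (Gm.combine σ τ) s :=
    le_ciInf fun τ => by
      have hr : _ ≤ Gm.reachProbFrom (Gm.combine σ τ) s :=
        le_ciSup (Gm.bddAbove_reachWithin σ τ s) n
      linarith [hσ τ s]
  have hsup : ⨅ τ, Gm.reachProbFrom (Gm.combine σ τ) s ≤ Gm.maxminFrom s :=
    le_ciSup (f := fun σ : Gm.TeamStrategy => ⨅ τ, Gm.reachProbFrom (Gm.combine σ τ) s)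
      ⟨Gm.vLim s, Set.forall_mem_range.2 fun σ => Gm.iInf_reachProbFrom_le_vLim σ s⟩ σ
  linarith

theorem maxminFrom_eq_vLim (s : Gm.State) : Gm.maxminFrom s = Gm.vLim s :=
  le_antisymm (ciSup_le fun σ => Gm.iInf_reachProbFrom_le_vLim σ s)
    (ciSup_le fun n => Gm.vIter_le_maxminFrom n s)

end Game

/-- For every state `s` of the game, the value iteration sequence
`(vIter n s)` converges, and its limit equals the max-min value of the game
started at `s`. -/
theorem value_iteration_converges_to_maxmin (Gm : Game) (s : Gm.State) :
    Filter.Tendsto (fun n => Gm.vIter n s) Filter.atTop (nhds (Gm.maxminFrom s)) := by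
  rw [Gm.maxminFrom_eq_vLim s]
  exact Gm.tendsto_vIter s
end
end

section
/- Let t ∈ [0,1]. If there exists a collective strategy for the team such that, against every strategy of the opponent, the probability of reaching the target set T from the initial state is strictly greater than t, then there exists a memoryless collective strategy with the same property. -/
/-!
Common framework: team concurrent stochastic reachability games.
-/

noncomputable section

namespace Game

variable (Gm : Game)

/-- The collective selector used by `σ` at state `s` with history `h`. -/
def teamSel (σ : Gm.TeamStrategy) (h : List Gm.State) (s : Gm.State) : Gm.TeamSelector s :=
  fun p => ⟨(σ p).toFun h s, (σ p).nonneg h s, (σ p).support_av h s, (σ p).sum_one h s⟩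

/-- The memoryless collective strategy playing the selector `ξ s` at each state `s`. -/
def ofSel (ξ : ∀ s, Gm.TeamSelector s) : Gm.TeamStrategy :=
  fun p => ⟨fun _ s => (ξ s p).toFun, fun _ s => (ξ s p).nonneg,
    fun _ s => (ξ s p).support_av, fun _ s => (ξ s p).sum_one⟩

/-- The pure opponent strategy playing the joint action `b h s`. -/
def pureOpp (b : List Gm.State → ∀ s : Gm.State, {b : Gm.OppAct // Gm.OppAvailable s b}) :
    Gm.OppStrategy := fun p =>
  { toFun := fun h s a => if a = (b h s).1 p then 1 else 0
    nonneg := fun h s a => by split_ifs <;> norm_num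
    support_av := fun h s a ha => by
      rw [if_neg]
      rintro rfl
      exact ha ((b h s).2 p)
    sum_one := fun h s => by simp }

instance (s : Gm.State) : Nonempty {b : Gm.OppAct // Gm.OppAvailable s b} :=
  ⟨⟨fun p => (Gm.av_nonempty p.1 s).choose, fun p => (Gm.av_nonempty p.1 s).choose_spec⟩⟩

instance (s : Gm.State) : Nonempty (Gm.TeamSelector s) :=
  ⟨fun p => ⟨fun a => if a = (Gm.av_nonempty p.1 s).choose then 1 else 0,
    fun a => by split_ifs <;> norm_num,
    fun a ha => by
      rw [if_neg]
      rintro rfl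
      exact ha (Gm.av_nonempty p.1 s).choose_spec,
    by simp⟩⟩

variable {Gm}

theorem sum_prod_selector {s : Gm.State} (ξ : Gm.TeamSelector s) :
    ∑ a : Gm.TeamAct, ∏ p, (ξ p).toFun (a p) = 1 := by
  rw [← Fintype.prod_sum]
  exact Finset.prod_eq_one fun p _ => (ξ p).sum_one

theorem sum_prod_opp (τ : Gm.OppStrategy) (h : List Gm.State) (s : Gm.State) :
    ∑ b : Gm.OppAct, ∏ p, (τ p).toFun h s (b p) = 1 := by
  rw [← Fintype.prod_sum]
  exact Finset.prod_eq_one fun p _ => (τ p).sum_one h s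

theorem preTeamAct_mono {v w : Gm.State → ℝ} (hvw : ∀ t, v t ≤ w t) {s : Gm.State}
    (ξ : Gm.TeamSelector s) (b : Gm.OppAct) :
    Gm.preTeamAct v s ξ b ≤ Gm.preTeamAct w s ξ b :=
  Finset.sum_le_sum fun _ _ => mul_le_mul_of_nonneg_left
    (Finset.sum_le_sum fun t _ => mul_le_mul_of_nonneg_left (hvw t) (Gm.trans_nonneg _ _ _))
    (Finset.prod_nonneg fun p _ => (ξ p).nonneg _)

theorem preTeamAct_const (c : ℝ) {s : Gm.State} (ξ : Gm.TeamSelector s) (b : Gm.OppAct) :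
    Gm.preTeamAct (fun _ => c) s ξ b = c := by
  simp only [preTeamAct, ← Finset.sum_mul, Gm.trans_sum, sum_prod_selector, one_mul]

theorem preTeamAct_const_mul (c : ℝ) (v : Gm.State → ℝ) {s : Gm.State}
    (ξ : Gm.TeamSelector s) (b : Gm.OppAct) :
    Gm.preTeamAct (fun t => c * v t) s ξ b = c * Gm.preTeamAct v s ξ b := by
  simp only [preTeamAct, Finset.mul_sum]
  exact Finset.sum_congr rfl fun _ _ => Finset.sum_congr rfl fun _ _ => by ring

theorem preTeamAct_sub_const (c : ℝ) (v : Gm.State → ℝ) {s : Gm.State}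
    (ξ : Gm.TeamSelector s) (b : Gm.OppAct) :
    Gm.preTeamAct (fun t => v t - c) s ξ b = Gm.preTeamAct v s ξ b - c := by
  have hc := preTeamAct_const c ξ b
  simp only [preTeamAct] at hc
  simp only [preTeamAct, mul_sub, Finset.sum_sub_distrib, hc]

theorem preTeamAct_nonneg {v : Gm.State → ℝ} (hv : ∀ t, 0 ≤ v t) {s : Gm.State}
    (ξ : Gm.TeamSelector s) (b : Gm.OppAct) : 0 ≤ Gm.preTeamAct v s ξ b :=
  (preTeamAct_const 0 ξ b).symm.le.trans (preTeamAct_mono hv ξ b)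

theorem preTeamAct_le_one {v : Gm.State → ℝ} (hv : ∀ t, v t ≤ 1) {s : Gm.State}
    (ξ : Gm.TeamSelector s) (b : Gm.OppAct) : Gm.preTeamAct v s ξ b ≤ 1 :=
  (preTeamAct_mono hv ξ b).trans (preTeamAct_const 1 ξ b).le

theorem tendsto_preTeamAct {v : ℕ → Gm.State → ℝ} {w : Gm.State → ℝ}
    (hv : ∀ t, Filter.Tendsto (fun n => v n t) Filter.atTop (nhds (w t))) {s : Gm.State}
    (ξ : Gm.TeamSelector s) (b : Gm.OppAct) :
    Filter.Tendsto (fun n => Gm.preTeamAct (v n) s ξ b) Filter.atTop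
      (nhds (Gm.preTeamAct w s ξ b)) :=
  tendsto_finsetSum _ fun _ _ => (tendsto_finsetSum _ fun t _ => (hv t).const_mul _).const_mul _

theorem prod_combine (σ : Gm.TeamStrategy) (τ : Gm.OppStrategy) (h : List Gm.State)
    (s : Gm.State) (a : Gm.TeamAct) (b : Gm.OppAct) :
    ∏ p, (Gm.combine σ τ p).toFun h s (Gm.combineAct a b p) =
      (∏ p, (σ p).toFun h s (a p)) * ∏ p, (τ p).toFun h s (b p) := by
  rw [← Fintype.prod_subtype_mul_prod_subtype (fun p => p ∈ Gm.team)
    (fun p => (Gm.combine σ τ p).toFun h s (Gm.combineAct a b p))]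
  congr 1
  · refine Finset.prod_congr (by ext; simp) fun p _ => ?_
    simp [combine, combineAct, p.2]
  · refine Finset.prod_congr (by ext; simp) fun p _ => ?_
    simp [combine, combineAct, p.2]

theorem sum_stepProb_combine_mul (σ : Gm.TeamStrategy) (τ : Gm.OppStrategy)
    (h : List Gm.State) (s : Gm.State) (v : Gm.State → ℝ) :
    ∑ t, Gm.stepProb (Gm.combine σ τ) h s t * v t =
      ∑ b : Gm.OppAct, (∏ p, (τ p).toFun h s (b p)) *
        Gm.preTeamAct v s (Gm.teamSel σ h s) b := by
  have key : ∑ t, Gm.stepProb (Gm.combine σ τ) h s t * v t =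
      ∑ a : (p : Gm.Player) → Gm.Act p, (∏ p, (Gm.combine σ τ p).toFun h s (a p)) *
        ∑ t, Gm.trans s a t * v t := by
    simp only [stepProb, Finset.sum_mul, Finset.mul_sum]
    rw [Finset.sum_comm]
    exact Finset.sum_congr rfl fun _ _ => Finset.sum_congr rfl fun _ _ => by ring
  rw [key, ← (Equiv.piEquivPiSubtypeProd (fun p => p ∈ Gm.team) Gm.Act).symm.sum_comp,
    Fintype.sum_prod_type, Finset.sum_comm]
  refine Finset.sum_congr rfl fun b _ => ?_
  rw [preTeamAct, Finset.mul_sum]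
  refine Finset.sum_congr rfl fun a _ => ?_
  have := prod_combine σ τ h s a b
  change (∏ p, (Gm.combine σ τ p).toFun h s (Gm.combineAct a b p)) *
    ∑ t, Gm.trans s (Gm.combineAct a b) t * v t = _
  rw [this]
  simp only [teamSel]
  ring

theorem le_sum_opp_mul (τ : Gm.OppStrategy) (h : List Gm.State) (s : Gm.State)
    {f : Gm.OppAct → ℝ} {c : ℝ} (hf : ∀ b, Gm.OppAvailable s b → c ≤ f b) :
    c ≤ ∑ b : Gm.OppAct, (∏ p, (τ p).toFun h s (b p)) * f b := by
  rw [← one_mul c, ← sum_prod_opp τ h s, Finset.sum_mul]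
  refine Finset.sum_le_sum fun b _ => ?_
  by_cases hb : Gm.OppAvailable s b
  · exact mul_le_mul_of_nonneg_left (hf b hb) (Finset.prod_nonneg fun p _ => (τ p).nonneg _ _ _)
  · obtain ⟨p, hp⟩ := not_forall.1 hb
    rw [Finset.prod_eq_zero (Finset.mem_univ p) ((τ p).support_av h s _ hp), zero_mul, zero_mul]

theorem sum_pureOpp_mul
    (b : List Gm.State → ∀ s : Gm.State, {b : Gm.OppAct // Gm.OppAvailable s b})
    (h : List Gm.State) (s : Gm.State) (f : Gm.OppAct → ℝ) :
    ∑ c : Gm.OppAct, (∏ p, (Gm.pureOpp b p).toFun h s (c p)) * f c = f (b h s).1 := by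
  rw [Fintype.sum_eq_single (b h s).1]
  · simp [pureOpp]
  · intro c hc
    obtain ⟨p, hp⟩ := Function.ne_iff.1 hc
    rw [Finset.prod_eq_zero (Finset.mem_univ p) (by simp [pureOpp, hp]), zero_mul]

theorem reachWithin_nonneg (σ : Gm.TeamStrategy) (τ : Gm.OppStrategy) (n : ℕ)
    (h : List Gm.State) (s : Gm.State) : 0 ≤ Gm.reachWithin (Gm.combine σ τ) n h s := by
  induction n generalizing h s with
  | zero => rw [reachWithin]; split_ifs <;> norm_num
  | succ n ih =>
    rw [reachWithin]
    split_ifs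
    · norm_num
    · rw [sum_stepProb_combine_mul]
      exact le_sum_opp_mul τ h s fun b _ => preTeamAct_nonneg (fun t => ih _ t) _ b

theorem reachWithin_le_one (σ : Gm.TeamStrategy) (τ : Gm.OppStrategy) (n : ℕ)
    (h : List Gm.State) (s : Gm.State) : Gm.reachWithin (Gm.combine σ τ) n h s ≤ 1 := by
  induction n generalizing h s with
  | zero => rw [reachWithin]; split_ifs <;> norm_num
  | succ n ih =>
    rw [reachWithin]
    split_ifs
    · norm_num
    · rw [sum_stepProb_combine_mul, ← sum_prod_opp τ h s]
      exact Finset.sum_le_sum fun b _ => mul_le_of_le_one_right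
        (Finset.prod_nonneg fun p _ => (τ p).nonneg _ _ _)
        (preTeamAct_le_one (fun t => ih _ t) _ b)

variable (Gm) in
/-- The least probability, over the opponent's behaviours, of visiting the target within `n` steps
against `σ`, starting at `s` with history `h`. -/
def minReach (σ : Gm.TeamStrategy) : ℕ → List Gm.State → Gm.State → ℝ
  | 0, _, s => if s ∈ Gm.target then 1 else 0
  | n + 1, h, s =>
      if s ∈ Gm.target then 1
      else ⨅ b : {b : Gm.OppAct // Gm.OppAvailable s b},
        Gm.preTeamAct (minReach σ n (h ++ [s])) s (Gm.teamSel σ h s) b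

theorem iInf_opp_le {s : Gm.State} (f : Gm.OppAct → ℝ) {b : Gm.OppAct}
    (hb : Gm.OppAvailable s b) :
    ⨅ b : {b : Gm.OppAct // Gm.OppAvailable s b}, f b ≤ f b :=
  ciInf_le (f := fun b : {b : Gm.OppAct // Gm.OppAvailable s b} => f b)
    (Set.finite_range _).bddBelow ⟨b, hb⟩

theorem iInf_opp_mono {s : Gm.State} {f g : Gm.OppAct → ℝ} (hfg : ∀ b, f b ≤ g b) :
    ⨅ b : {b : Gm.OppAct // Gm.OppAvailable s b}, f b ≤
      ⨅ b : {b : Gm.OppAct // Gm.OppAvailable s b}, g b :=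
  le_ciInf fun b => (iInf_opp_le f b.2).trans (hfg b)

theorem iInf_opp_le_one {v : Gm.State → ℝ} (hv : ∀ t, v t ≤ 1) {s : Gm.State}
    (ξ : Gm.TeamSelector s) :
    ⨅ b : {b : Gm.OppAct // Gm.OppAvailable s b}, Gm.preTeamAct v s ξ b ≤ 1 :=
  have ⟨b⟩ : Nonempty {b : Gm.OppAct // Gm.OppAvailable s b} := inferInstance
  (iInf_opp_le _ b.2).trans (preTeamAct_le_one hv ξ b)

theorem minReach_nonneg (σ : Gm.TeamStrategy) (n : ℕ) (h : List Gm.State) (s : Gm.State) :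
    0 ≤ Gm.minReach σ n h s := by
  induction n generalizing h s with
  | zero => rw [minReach]; split_ifs <;> norm_num
  | succ n ih =>
    rw [minReach]
    split_ifs
    · norm_num
    · exact le_ciInf fun b => preTeamAct_nonneg (fun t => ih _ t) _ _

theorem minReach_le_one (σ : Gm.TeamStrategy) (n : ℕ) (h : List Gm.State) (s : Gm.State) :
    Gm.minReach σ n h s ≤ 1 := by
  induction n generalizing h s with
  | zero => rw [minReach]; split_ifs <;> norm_num
  | succ n ih =>
    rw [minReach]
    split_ifs
    · norm_num
    · exact iInf_opp_le_one (fun t => ih _ t) _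

theorem minReach_le_succ (σ : Gm.TeamStrategy) (n : ℕ) (h : List Gm.State) (s : Gm.State) :
    Gm.minReach σ n h s ≤ Gm.minReach σ (n + 1) h s := by
  induction n generalizing h s with
  | zero =>
    by_cases hs : s ∈ Gm.target
    · simp [minReach, hs]
    · rw [minReach, if_neg hs]
      exact minReach_nonneg σ _ h s
  | succ n ih =>
    rw [minReach, minReach]
    split_ifs
    · exact le_rfl
    · exact iInf_opp_mono fun b => preTeamAct_mono (fun t => ih _ t) _ b

theorem bddAbove_minReach (σ : Gm.TeamStrategy) (h : List Gm.State) (s : Gm.State) :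
    BddAbove (Set.range fun n => Gm.minReach σ n h s) :=
  ⟨1, Set.forall_mem_range.2 fun n => minReach_le_one σ n h s⟩

theorem exists_opp_preTeamAct_iSup_le (σ : Gm.TeamStrategy) (h : List Gm.State) {s : Gm.State}
    (hs : s ∉ Gm.target) :
    ∃ b : {b : Gm.OppAct // Gm.OppAvailable s b},
      Gm.preTeamAct (fun t => ⨆ n, Gm.minReach σ n (h ++ [s]) t) s (Gm.teamSel σ h s) b ≤
        ⨆ n, Gm.minReach σ n h s := by
  by_contra! hlt
  have hev : ∀ b : {b : Gm.OppAct // Gm.OppAvailable s b}, ∀ᶠ n in Filter.atTop,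
      ⨆ n, Gm.minReach σ n h s <
        Gm.preTeamAct (Gm.minReach σ n (h ++ [s])) s (Gm.teamSel σ h s) b := fun b =>
    (tendsto_preTeamAct (fun t => tendsto_atTop_ciSup
      (monotone_nat_of_le_succ fun n => minReach_le_succ σ n (h ++ [s]) t)
      (bddAbove_minReach σ _ t)) _ _).eventually_const_lt (hlt b)
  obtain ⟨n, hn⟩ := (Filter.eventually_all.2 hev).exists
  obtain ⟨b, hb⟩ := exists_eq_ciInf_of_finite
    (f := fun b : {b : Gm.OppAct // Gm.OppAvailable s b} =>
      Gm.preTeamAct (Gm.minReach σ n (h ++ [s])) s (Gm.teamSel σ h s) b)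
  have hle := le_ciSup (bddAbove_minReach σ h s) (n + 1)
  rw [minReach, if_neg hs, ← hb] at hle
  exact (hn b).not_ge hle

/-- Some opponent strategy keeps the reachability probability below the limit of the
finite-horizon minima. -/
theorem exists_opp_reachProb_le (σ : Gm.TeamStrategy) :
    ∃ τ : Gm.OppStrategy, Gm.reachProb (Gm.combine σ τ) ≤ ⨆ n, Gm.minReach σ n [] Gm.init := by
  have hex : ∀ h s, ∃ b : {b : Gm.OppAct // Gm.OppAvailable s b}, s ∉ Gm.target →
      Gm.preTeamAct (fun t => ⨆ n, Gm.minReach σ n (h ++ [s]) t) s (Gm.teamSel σ h s) b ≤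
        ⨆ n, Gm.minReach σ n h s := by
    intro h s
    by_cases hs : s ∈ Gm.target
    · exact ⟨Classical.arbitrary _, fun hs' => absurd hs hs'⟩
    · obtain ⟨b, hb⟩ := exists_opp_preTeamAct_iSup_le σ h hs
      exact ⟨b, fun _ => hb⟩
  choose b hb using hex
  have key : ∀ n h s, Gm.reachWithin (Gm.combine σ (Gm.pureOpp b)) n h s ≤
      ⨆ n, Gm.minReach σ n h s := by
    intro n
    induction n with
    | zero => exact fun h s => le_ciSup (bddAbove_minReach σ h s) 0
    | succ n ih =>
      intro h s
      rw [reachWithin]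
      split_ifs with hs
      · have := le_ciSup (bddAbove_minReach σ h s) 0
        rwa [minReach, if_pos hs] at this
      · rw [sum_stepProb_combine_mul, sum_pureOpp_mul]
        exact (preTeamAct_mono (fun t => ih _ t) _ _).trans (hb h s hs)
  exact ⟨Gm.pureOpp b, ciSup_le fun n => key n [] Gm.init⟩

variable (Gm) in
/-- The value of the `n`-step game in which each step before the target costs a factor `lam`. -/
def discVal (lam : ℝ) : ℕ → Gm.State → ℝ
  | 0, s => if s ∈ Gm.target then 1 else 0
  | n + 1, s =>
      if s ∈ Gm.target then 1
      else lam * ⨆ ξ : Gm.TeamSelector s, ⨅ b : {b : Gm.OppAct // Gm.OppAvailable s b},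
        Gm.preTeamAct (discVal lam n) s ξ b

theorem bddAbove_iInf_opp {v : Gm.State → ℝ} (hv : ∀ t, v t ≤ 1) (s : Gm.State) :
    BddAbove (Set.range fun ξ : Gm.TeamSelector s =>
      ⨅ b : {b : Gm.OppAct // Gm.OppAvailable s b}, Gm.preTeamAct v s ξ b) :=
  ⟨1, Set.forall_mem_range.2 fun ξ => iInf_opp_le_one hv ξ⟩

theorem discVal_nonneg {lam : ℝ} (h0 : 0 ≤ lam) (n : ℕ) (s : Gm.State) :
    0 ≤ Gm.discVal lam n s := by
  induction n generalizing s with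
  | zero => rw [discVal]; split_ifs <;> norm_num
  | succ n ih =>
    rw [discVal]
    split_ifs
    · norm_num
    · exact mul_nonneg h0 (Real.iSup_nonneg fun ξ =>
        Real.iInf_nonneg fun b => preTeamAct_nonneg ih ξ b)

theorem discVal_le_one {lam : ℝ} (h0 : 0 ≤ lam) (h1 : lam ≤ 1) (n : ℕ) (s : Gm.State) :
    Gm.discVal lam n s ≤ 1 := by
  induction n generalizing s with
  | zero => rw [discVal]; split_ifs <;> norm_num
  | succ n ih =>
    rw [discVal]
    split_ifs
    · norm_num
    · exact mul_le_one₀ h1 (Real.iSup_nonneg fun ξ =>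
        Real.iInf_nonneg fun b => preTeamAct_nonneg (discVal_nonneg h0 n) ξ b)
        (ciSup_le fun ξ => iInf_opp_le_one ih ξ)

theorem discVal_le_succ {lam : ℝ} (h0 : 0 ≤ lam) (h1 : lam ≤ 1) (n : ℕ) (s : Gm.State) :
    Gm.discVal lam n s ≤ Gm.discVal lam (n + 1) s := by
  induction n generalizing s with
  | zero =>
    by_cases hs : s ∈ Gm.target
    · simp [discVal, hs]
    · rw [discVal, if_neg hs]
      exact discVal_nonneg h0 _ s
  | succ n ih =>
    rw [discVal, discVal]
    split_ifs
    · exact le_rfl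
    · exact mul_le_mul_of_nonneg_left
        (ciSup_mono (bddAbove_iInf_opp (discVal_le_one h0 h1 (n + 1)) s) fun ξ =>
          iInf_opp_mono fun b => preTeamAct_mono ih ξ b) h0

theorem pow_mul_minReach_le_discVal {lam : ℝ} (h0 : 0 ≤ lam) (h1 : lam ≤ 1)
    (σ : Gm.TeamStrategy) (n : ℕ) (h : List Gm.State) (s : Gm.State) :
    lam ^ n * Gm.minReach σ n h s ≤ Gm.discVal lam n s := by
  induction n generalizing h s with
  | zero => simp [minReach, discVal]
  | succ n ih =>
    rw [minReach, discVal]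
    split_ifs
    · rw [mul_one]
      exact pow_le_one₀ h0 h1
    · rw [pow_succ', mul_assoc]
      refine mul_le_mul_of_nonneg_left (le_ciSup_of_le
        (bddAbove_iInf_opp (discVal_le_one h0 h1 n) s) (Gm.teamSel σ h s) ?_) h0
      refine le_ciInf fun b => ?_
      calc _ ≤ lam ^ n * Gm.preTeamAct (Gm.minReach σ n (h ++ [s])) s (Gm.teamSel σ h s) b :=
            mul_le_mul_of_nonneg_left (iInf_opp_le _ b.2) (pow_nonneg h0 n)
        _ = Gm.preTeamAct (fun t => lam ^ n * Gm.minReach σ n (h ++ [s]) t) s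
              (Gm.teamSel σ h s) b := (preTeamAct_const_mul _ _ _ _).symm
        _ ≤ _ := preTeamAct_mono (fun t => ih _ t) _ _

theorem exists_selector_discVal_le {μ : ℝ} (h0 : 0 < μ) (h1 : μ < 1) (n : ℕ) {s : Gm.State}
    (hs : s ∉ Gm.target) :
    ∃ ξ : Gm.TeamSelector s, ∀ b, Gm.OppAvailable s b →
      Gm.discVal (μ ^ 2) n s ≤ μ * Gm.preTeamAct (Gm.discVal (μ ^ 2) n) s ξ b := by
  have hl0 : 0 ≤ μ ^ 2 := sq_nonneg μ
  have hl1 : μ ^ 2 ≤ 1 := pow_le_one₀ h0.le h1.le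
  rcases (discVal_nonneg hl0 n s).eq_or_lt with hz | hpos
  · rw [← hz]
    exact ⟨Classical.arbitrary _, fun b _ =>
      mul_nonneg h0.le (preTeamAct_nonneg (discVal_nonneg hl0 n) _ b)⟩
  · have hle := discVal_le_succ hl0 hl1 n s
    rw [discVal.eq_def _ _ (n + 1)] at hle
    simp only [if_neg hs] at hle
    have hlt : Gm.discVal (μ ^ 2) n s / μ <
        ⨆ ξ : Gm.TeamSelector s, ⨅ b : {b : Gm.OppAct // Gm.OppAvailable s b},
          Gm.preTeamAct (Gm.discVal (μ ^ 2) n) s ξ b := by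
      set X := ⨆ ξ : Gm.TeamSelector s, ⨅ b : {b : Gm.OppAct // Gm.OppAvailable s b},
          Gm.preTeamAct (Gm.discVal (μ ^ 2) n) s ξ b
      have hX : 0 < X := pos_of_mul_pos_right (hpos.trans_le hle) hl0
      rw [div_lt_iff₀ h0]
      nlinarith [mul_pos (mul_pos h0 hX) (sub_pos.2 h1)]
    obtain ⟨ξ, hξ⟩ := exists_lt_of_lt_ciSup hlt
    refine ⟨ξ, fun b hb => ?_⟩
    have := hξ.le.trans (iInf_opp_le _ hb)
    rwa [div_le_iff₀ h0, mul_comm] at this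

/-- If `u ≤ 1` and the selectors `ξ` guarantee that `u` is dominated by `μ` times its expected
value after one step outside the target, then playing `ξ` reaches the target with probability at
least `u`. -/
theorem le_reachProb_ofSel {u : Gm.State → ℝ} (hu : ∀ s, u s ≤ 1) {μ : ℝ} (h0 : 0 ≤ μ)
    (h1 : μ < 1) (ξ : ∀ s, Gm.TeamSelector s)
    (hξ : ∀ s, s ∉ Gm.target → ∀ b, Gm.OppAvailable s b → u s ≤ μ * Gm.preTeamAct u s (ξ s) b)
    (τ : Gm.OppStrategy) : u Gm.init ≤ Gm.reachProb (Gm.combine (Gm.ofSel ξ) τ) := by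
  have key : ∀ k h s, u s - μ ^ k ≤ Gm.reachWithin (Gm.combine (Gm.ofSel ξ) τ) k h s := by
    intro k
    induction k with
    | zero =>
      intro h s
      have := reachWithin_nonneg (Gm.ofSel ξ) τ 0 h s
      linarith [hu s, pow_zero μ]
    | succ k ih =>
      intro h s
      by_cases hs : s ∈ Gm.target
      · rw [reachWithin, if_pos hs]
        linarith [hu s, pow_nonneg h0 (k + 1)]
      rw [reachWithin, if_neg hs, sum_stepProb_combine_mul]
      refine le_sum_opp_mul τ h s fun b hb => ?_
      have hmono := preTeamAct_mono (fun t => ih (h ++ [s]) t) (ξ s) b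
      rw [preTeamAct_sub_const] at hmono
      have hnn := preTeamAct_nonneg
        (fun t => reachWithin_nonneg (Gm.ofSel ξ) τ k (h ++ [s]) t) (ξ s) b
      change _ ≤ Gm.preTeamAct _ s (ξ s) b
      have hstep := hξ s hs b hb
      rw [pow_succ']
      nlinarith [mul_le_mul_of_nonneg_left hmono h0, mul_nonneg hnn (sub_nonneg.2 h1.le)]
  have hbdd : BddAbove (Set.range fun n =>
      Gm.reachWithin (Gm.combine (Gm.ofSel ξ) τ) n [] Gm.init) :=
    ⟨1, Set.forall_mem_range.2 fun n => reachWithin_le_one _ τ n [] Gm.init⟩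
  have hlim : Filter.Tendsto (fun k : ℕ => u Gm.init - μ ^ k) Filter.atTop
      (nhds (u Gm.init)) := by
    simpa using (tendsto_pow_atTop_nhds_zero_of_lt_one h0 h1).const_sub (u Gm.init)
  exact le_of_tendsto' hlim fun k => (key k [] Gm.init).trans (le_ciSup hbdd k)

end Game

/-- If some collective strategy guarantees reaching the target with
probability strictly greater than `t` against every opponent strategy, then some
memoryless collective strategy does as well. -/
theorem threshold_memoryless_sufficient (Gm : Game) (t : ℝ) (ht0 : 0 ≤ t) (ht1 : t ≤ 1)
    (h : ∃ σ : Gm.TeamStrategy, ∀ τ : Gm.OppStrategy, t < Gm.reachProb (Gm.combine σ τ)) :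
    ∃ σ : Gm.TeamStrategy, Gm.MemorylessTeam σ ∧
      ∀ τ : Gm.OppStrategy, t < Gm.reachProb (Gm.combine σ τ) := by
  obtain ⟨σ, hσ⟩ := h
  obtain ⟨τ, hτ⟩ := Game.exists_opp_reachProb_le σ
  obtain ⟨n, hn⟩ := exists_lt_of_lt_ciSup ((hσ τ).trans_le hτ)
  have hcont : Filter.Tendsto (fun μ : ℝ => (μ ^ 2) ^ n * Gm.minReach σ n [] Gm.init)
      (nhdsWithin 1 (Set.Iio 1)) (nhds (Gm.minReach σ n [] Gm.init)) := by
    have hc : Continuous fun μ : ℝ => (μ ^ 2) ^ n * Gm.minReach σ n [] Gm.init := by fun_prop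
    simpa using (hc.tendsto 1).mono_left nhdsWithin_le_nhds
  obtain ⟨μ, hμ, h0, h1⟩ := ((hcont.eventually_const_lt hn).and
    (Ioo_mem_nhdsLT (zero_lt_one (α := ℝ)))).exists
  have hsel : ∀ s, ∃ ξ : Gm.TeamSelector s, s ∉ Gm.target → ∀ b, Gm.OppAvailable s b →
      Gm.discVal (μ ^ 2) n s ≤ μ * Gm.preTeamAct (Gm.discVal (μ ^ 2) n) s ξ b := by
    intro s
    by_cases hs : s ∈ Gm.target
    · exact ⟨Classical.arbitrary _, fun hs' => absurd hs hs'⟩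
    · obtain ⟨ξ, hξ⟩ := Game.exists_selector_discVal_le h0 h1 n hs
      exact ⟨ξ, fun _ => hξ⟩
  choose ξ hξ using hsel
  have hl1 : μ ^ 2 ≤ 1 := pow_le_one₀ h0.le h1.le
  refine ⟨Gm.ofSel ξ, fun p h h' s => rfl, fun τ => ?_⟩
  calc t < (μ ^ 2) ^ n * Gm.minReach σ n [] Gm.init := hμ
    _ ≤ Gm.discVal (μ ^ 2) n Gm.init :=
      Game.pow_mul_minReach_le_discVal (sq_nonneg μ) hl1 σ n [] Gm.init
    _ ≤ _ := Game.le_reachProb_ofSel (Game.discVal_le_one (sq_nonneg μ) hl1 n) h0.le h1 ξ hξ τ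
end
end

section
/- For every ε > 0, there exists a collective strategy σ̄_Π for the team such that, for every opponent strategy and every state s, the probability of reaching the target set T from s under the resulting strategy profile is at least w(s) − ε, where w denotes the pointwise limit of the value iteration sequence. -/
/-!
Common framework: team concurrent stochastic reachability games.
-/

noncomputable section

namespace Game

variable {Gm : Game}

/-- The product of finitely many probability weights has total mass one. -/
lemma sum_prod_eq_one {ι : Type*} [Fintype ι] [DecidableEq ι] {α : ι → Type*}
    [∀ i, Fintype (α i)] (f : (i : ι) → α i → ℝ) (hf : ∀ i, ∑ a, f i a = 1) :
    ∑ x : (i : ι) → α i, ∏ i, f i (x i) = 1 := by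
  have h := Finset.prod_univ_sum (fun i => (Finset.univ : Finset (α i))) f
  rw [Fintype.piFinset_univ] at h
  rw [← h]
  exact Finset.prod_eq_one fun i _ => hf i

/-- A weighted average of numbers in `[0, 1]` lies in `[0, 1]`. -/
lemma sum_mul_mem_Icc {ι : Type*} [Fintype ι] {c x : ι → ℝ} (hc : ∀ i, 0 ≤ c i)
    (hsum : ∑ i, c i = 1) (hx : ∀ i, x i ∈ Set.Icc (0 : ℝ) 1) :
    ∑ i, c i * x i ∈ Set.Icc (0 : ℝ) 1 := by
  refine ⟨Finset.sum_nonneg fun i _ => mul_nonneg (hc i) (hx i).1, ?_⟩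
  calc ∑ i, c i * x i ≤ ∑ i, c i :=
        Finset.sum_le_sum fun i _ => mul_le_of_le_one_right (hc i) (hx i).2
    _ = 1 := hsum

lemma stepProb_nonneg (π : (p : Gm.Player) → Strategy Gm.toGameStructure p)
    (h : List Gm.State) (s t : Gm.State) : 0 ≤ Gm.stepProb π h s t :=
  Finset.sum_nonneg fun _ _ =>
    mul_nonneg (Finset.prod_nonneg fun p _ => (π p).nonneg _ _ _) (Gm.trans_nonneg _ _ _)

lemma sum_stepProb_mul (π : (p : Gm.Player) → Strategy Gm.toGameStructure p)
    (h : List Gm.State) (s : Gm.State) (v : Gm.State → ℝ) :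
    ∑ t, Gm.stepProb π h s t * v t =
      ∑ a : (p : Gm.Player) → Gm.Act p,
        (∏ p, (π p).toFun h s (a p)) * ∑ t, Gm.trans s a t * v t := by
  simp only [stepProb, Finset.sum_mul, Finset.mul_sum, mul_assoc]
  exact Finset.sum_comm

lemma sum_stepProb (π : (p : Gm.Player) → Strategy Gm.toGameStructure p)
    (h : List Gm.State) (s : Gm.State) : ∑ t, Gm.stepProb π h s t = 1 := by
  have key := sum_stepProb_mul π h s fun _ => 1
  simp only [mul_one, Gm.trans_sum] at key
  rw [key]
  exact sum_prod_eq_one (fun p => (π p).toFun h s) fun p => (π p).sum_one h s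

lemma reachWithin_mem_Icc (π : (p : Gm.Player) → Strategy Gm.toGameStructure p) (n : ℕ) :
    ∀ (h : List Gm.State) (s : Gm.State), Gm.reachWithin π n h s ∈ Set.Icc (0 : ℝ) 1 := by
  induction n with
  | zero =>
    intro h s
    simp only [reachWithin]
    split_ifs <;> simp
  | succ n ih =>
    intro h s
    simp only [reachWithin]
    split_ifs
    · simp
    · exact sum_mul_mem_Icc (stepProb_nonneg π h s) (sum_stepProb π h s) fun t => ih _ t

lemma preSel_mem_Icc {v : Gm.State → ℝ} (hv : ∀ t, v t ∈ Set.Icc (0 : ℝ) 1) (s : Gm.State)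
    (ξ : Gm.TeamSelector s) (ζ : Gm.OppSelector s) :
    Gm.preSel v s ξ ζ ∈ Set.Icc (0 : ℝ) 1 :=
  sum_mul_mem_Icc ζ.nonneg ζ.sum_one fun _ =>
    sum_mul_mem_Icc (fun _ => Finset.prod_nonneg fun p _ => (ξ p).nonneg _)
      (sum_prod_eq_one _ fun p => (ξ p).sum_one) fun _ =>
        sum_mul_mem_Icc (Gm.trans_nonneg _ _) (Gm.trans_sum _ _) hv

lemma bddBelow_range_preSel {v : Gm.State → ℝ} (hv : ∀ t, v t ∈ Set.Icc (0 : ℝ) 1)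
    (s : Gm.State) (ξ : Gm.TeamSelector s) : BddBelow (Set.range (Gm.preSel v s ξ)) :=
  ⟨0, by rintro _ ⟨ζ, rfl⟩; exact (preSel_mem_Icc hv s ξ ζ).1⟩

lemma pre_mem_Icc {v : Gm.State → ℝ} (hv : ∀ t, v t ∈ Set.Icc (0 : ℝ) 1) (s : Gm.State) :
    Gm.pre v s ∈ Set.Icc (0 : ℝ) 1 := by
  refine ⟨Real.iSup_nonneg fun ξ => Real.iInf_nonneg fun ζ => (preSel_mem_Icc hv s ξ ζ).1,
    Real.iSup_le (fun ξ => ?_) zero_le_one⟩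
  rcases isEmpty_or_nonempty (Gm.OppSelector s) with _ | ⟨⟨ζ⟩⟩
  · rw [Real.iInf_of_isEmpty]
    exact zero_le_one
  · exact (ciInf_le (bddBelow_range_preSel hv s ξ) ζ).trans (preSel_mem_Icc hv s ξ ζ).2

lemma vIter_mem_Icc (n : ℕ) : ∀ s, Gm.vIter n s ∈ Set.Icc (0 : ℝ) 1 := by
  induction n with
  | zero =>
    intro s
    simp only [vIter]
    split_ifs <;> simp
  | succ n ih => exact pre_mem_Icc ih

instance (G : GameStructure) (p : G.Player) (s : G.State) : Nonempty (Selector G p s) := by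
  obtain ⟨a, ha⟩ := G.av_nonempty p s
  refine ⟨⟨Pi.single a 1, fun b => ?_, fun b hb => ?_, by simp⟩⟩
  · by_cases h : b = a
    · subst h; simp
    · simp [h]
  · exact Pi.single_eq_of_ne (fun h => hb (by rw [h]; exact ha)) _

/-- The opponent selector played by a profile of individual opponent strategies. -/
def OppStrategy.selector (τ : Gm.OppStrategy) (h : List Gm.State) (s : Gm.State) :
    Gm.OppSelector s where
  toFun b := ∏ p, (τ p).toFun h s (b p)
  nonneg _ := Finset.prod_nonneg fun p _ => (τ p).nonneg _ _ _
  support_av b hb := by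
    simp only [OppAvailable, not_forall] at hb
    obtain ⟨p, hp⟩ := hb
    exact Finset.prod_eq_zero (Finset.mem_univ p) ((τ p).support_av h s _ hp)
  sum_one := sum_prod_eq_one _ fun p => (τ p).sum_one h s

/-- The team strategy that plays, after a history of length `n`, the selectors `ξ n`. -/
def TeamStrategy.ofSelectors (ξ : (n : ℕ) → (s : Gm.State) → Gm.TeamSelector s) :
    Gm.TeamStrategy := fun p =>
  { toFun := fun h s => (ξ h.length s p).toFun
    nonneg := fun h s => (ξ h.length s p).nonneg
    support_av := fun h s => (ξ h.length s p).support_av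
    sum_one := fun h s => (ξ h.length s p).sum_one }

lemma sum_stepProb_combine_mul_s9 (ξ : (n : ℕ) → (s : Gm.State) → Gm.TeamSelector s)
    (τ : Gm.OppStrategy) (h : List Gm.State) (s : Gm.State) (v : Gm.State → ℝ) :
    ∑ t, Gm.stepProb (Gm.combine (TeamStrategy.ofSelectors ξ) τ) h s t * v t =
      Gm.preSel v s (ξ h.length s) (OppStrategy.selector τ h s) := by
  have hprod (a : Gm.TeamAct) (b : Gm.OppAct) :
      ∏ p, (Gm.combine (TeamStrategy.ofSelectors ξ) τ p).toFun h s (Gm.combineAct a b p) =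
        (∏ p, (ξ h.length s p).toFun (a p)) * ∏ p, (τ p).toFun h s (b p) := by
    rw [← Fintype.prod_subtype_mul_prod_subtype (fun p => p ∈ Gm.team)]
    congr 1
    · refine Finset.prod_congr (Finset.ext fun _ => by simp) fun p _ => ?_
      simp only [combine, combineAct, dif_pos p.2]
      rfl
    · refine Finset.prod_congr rfl fun p _ => ?_
      simp only [combine, combineAct, dif_neg p.2]
  rw [sum_stepProb_mul, ← (Equiv.piEquivPiSubtypeProd (fun p => p ∈ Gm.team) Gm.Act).symm.sum_comp,
    Fintype.sum_prod_type, Finset.sum_comm]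
  simp only [preSel, preTeamAct, Finset.mul_sum (s := (Finset.univ : Finset Gm.TeamAct))]
  refine Finset.sum_congr rfl fun b _ => Finset.sum_congr rfl fun a _ => ?_
  change (∏ p, (Gm.combine (TeamStrategy.ofSelectors ξ) τ p).toFun h s (Gm.combineAct a b p)) *
    ∑ t, Gm.trans s (Gm.combineAct a b) t * v t = _
  rw [hprod]
  simp only [OppStrategy.selector]
  ring

/-- Some collective selector achieves `pre v s` up to an arbitrarily small error. -/
lemma exists_selector_le_preSel {v : Gm.State → ℝ} (hv : ∀ t, v t ∈ Set.Icc (0 : ℝ) 1)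
    (s : Gm.State) {δ : ℝ} (hδ : 0 < δ) :
    ∃ ξ : Gm.TeamSelector s, ∀ ζ : Gm.OppSelector s, Gm.pre v s - δ ≤ Gm.preSel v s ξ ζ := by
  obtain ⟨ξ, hξ⟩ := exists_lt_of_lt_ciSup (sub_lt_self (Gm.pre v s) hδ)
  exact ⟨ξ, fun ζ => hξ.le.trans (ciInf_le (bddBelow_range_preSel hv s ξ) ζ)⟩

/-- If `ξ k` is `δ`-optimal for one step with respect to `vIter k`, then playing
`ξ (N - 1)`, …, `ξ 0` guarantees `vIter m - m * δ` when `m` of the `N` steps remain. -/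
lemma vIter_sub_le_reachWithin (ξ : (n : ℕ) → (s : Gm.State) → Gm.TeamSelector s) {δ : ℝ}
    (hδ : 0 ≤ δ)
    (hξ : ∀ k s (ζ : Gm.OppSelector s),
      Gm.vIter (k + 1) s - δ ≤ Gm.preSel (Gm.vIter k) s (ξ k s) ζ)
    (τ : Gm.OppStrategy) (N m : ℕ) :
    ∀ (h : List Gm.State) (s : Gm.State), h.length + m = N →
      Gm.vIter m s - m * δ ≤ Gm.reachWithin
        (Gm.combine (TeamStrategy.ofSelectors fun n => ξ (N - 1 - n)) τ) m h s := by
  induction m with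
  | zero =>
    intro h s _
    simp [vIter, reachWithin]
  | succ m ih =>
    intro h s hN
    simp only [reachWithin]
    split_ifs with hs
    · have h1 := (vIter_mem_Icc (m + 1) s).2
      have h2 : 0 ≤ ((m + 1 : ℕ) : ℝ) * δ := by positivity
      linarith
    · set π := Gm.combine (TeamStrategy.ofSelectors fun n => ξ (N - 1 - n)) τ with hπ
      have hk : N - 1 - h.length = m := by omega
      have hstep := hξ m s (OppStrategy.selector τ h s)
      have hval := sum_stepProb_combine_mul_s9 (fun n => ξ (N - 1 - n)) τ h s (Gm.vIter m)
      rw [hk, ← hπ] at hval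
      calc Gm.vIter (m + 1) s - ((m + 1 : ℕ) : ℝ) * δ
          ≤ ∑ t, Gm.stepProb π h s t * Gm.vIter m t - m * δ := by
            rw [hval]
            push_cast
            linarith
        _ = ∑ t, Gm.stepProb π h s t * (Gm.vIter m t - m * δ) := by
            simp only [mul_sub, Finset.sum_sub_distrib, ← Finset.sum_mul, sum_stepProb, one_mul]
        _ ≤ _ := Finset.sum_le_sum fun t _ =>
            mul_le_mul_of_nonneg_left
              (ih (h ++ [s]) t (by rw [List.length_append, List.length_singleton]; omega))
              (stepProb_nonneg π h s t)

end Game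

/-- For every `ε > 0` there is a collective strategy guaranteeing,
from every state `s` and against every opponent strategy, reaching the target
with probability at least `w s - ε`, where `w` is the pointwise limit of the
value iteration sequence. -/
theorem eps_optimal_strategy_exists (Gm : Game) (w : Gm.State → ℝ)
    (hw : ∀ s, Filter.Tendsto (fun n => Gm.vIter n s) Filter.atTop (nhds (w s)))
    (ε : ℝ) (hε : 0 < ε) :
    ∃ σ : Gm.TeamStrategy, ∀ τ : Gm.OppStrategy, ∀ s : Gm.State,
      w s - ε ≤ Gm.reachProbFrom (Gm.combine σ τ) s := by
  have hev : ∀ᶠ n in Filter.atTop, ∀ s, w s - ε / 2 < Gm.vIter n s :=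
    Filter.eventually_all.2 fun s => (hw s).eventually_const_lt (by linarith)
  obtain ⟨N, hN⟩ := hev.exists
  set δ : ℝ := ε / 2 / (N + 1) with hδ
  have hδpos : 0 < δ := by positivity
  choose ξ hξ using fun (k : ℕ) (s : Gm.State) =>
    Game.exists_selector_le_preSel (Game.vIter_mem_Icc (Gm := Gm) k) s hδpos
  refine ⟨Game.TeamStrategy.ofSelectors fun n => ξ (N - 1 - n), fun τ s => ?_⟩
  have hreach := Game.vIter_sub_le_reachWithin ξ hδpos.le hξ τ N N [] s (by simp)
  have hNδ : N * δ ≤ ε / 2 := by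
    have h1 : (N + 1) * δ = ε / 2 := by rw [hδ]; field_simp
    linarith
  have hsup : Gm.reachWithin
      (Gm.combine (Game.TeamStrategy.ofSelectors fun n => ξ (N - 1 - n)) τ) N [] s ≤
      Gm.reachProbFrom (Gm.combine (Game.TeamStrategy.ofSelectors fun n => ξ (N - 1 - n)) τ) s :=
    le_ciSup (f := fun n => Gm.reachWithin _ n [] s)
      ⟨1, by rintro _ ⟨n, rfl⟩; exact (Game.reachWithin_mem_Icc _ n [] s).2⟩ N
  linarith [hN s]
end
end
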